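/- Let s = t be a positive integer and 0 ≤ a, b < s with gcd(s, a - b) = 1. Then the number of pairs (λ, μ) of s-core partitions such that β_i(μ) + a ∈ {β_{i+a}(λ), β_{i+a}(λ) + s} for all i ∈ ℤ/sℤ, and β_i(μ) + b ∈ {β_{i+b}(λ), β_{i+b}(λ) + s} for all i, equals (1/s)·C(s,a)·C(s,b). -/

import Mathlib

/-- A partition: a weakly decreasing sequence of non-negative integers,
with finitely many nonzero terms (indices are 0-based; `parts i` is `λ_{i+1}`). -/
structure Partition' where
  parts : ℕ → ℕ
  antitone : ∀ i j : ℕ, i ≤ j → parts j ≤ parts i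
  finite_support : ∃ N : ℕ, ∀ i : ℕ, N ≤ i → parts i = 0

/-- The beta-set `B(λ) = {λ_a - a : a ≥ 1}` of a partition. -/
def betaSet (lam : Partition') : Set ℤ :=
  Set.range fun i : ℕ => (lam.parts i : ℤ) - (i + 1)

/-- The shifted set `S + c`. -/
def shiftSet (S : Set ℤ) (c : ℤ) : Set ℤ := (fun x => x + c) '' S

/-- `λ` is an `s`-core (beta-set characterisation). -/
def IsCore (lam : Partition') (s : ℕ) : Prop :=
  ∀ x ∈ betaSet lam, x - (s : ℤ) ∈ betaSet lam

/-- `x` is the least element of the residue class `i` mod `s` not lying in `B(λ)`,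
i.e. `x = β_i(λ)`. -/
def IsBetaNum (s : ℕ) (lam : Partition') (i : ZMod s) (x : ℤ) : Prop :=
  x ∉ betaSet lam ∧ (x : ZMod s) = i ∧
    ∀ y : ℤ, y < x → (y : ZMod s) = i → y ∈ betaSet lam

theorem betaFun_strictAnti (lam : Partition') :
    StrictAnti fun i : ℕ => (lam.parts i : ℤ) - (i + 1) := by
  intro i j hij
  have h := lam.antitone i j hij.le
  simp only
  omega

theorem Partition'.ext_parts {lam mu : Partition'} (h : lam.parts = mu.parts) : lam = mu := by
  cases lam; cases mu; cases h; rfl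

theorem betaSet_injective : Function.Injective betaSet := by
  intro lam mu h
  have h' : (fun i : ℕ => OrderDual.toDual ((lam.parts i : ℤ) - (i + 1))) =
      fun i : ℕ => OrderDual.toDual ((mu.parts i : ℤ) - (i + 1)) := by
    refine (StrictMono.range_inj (betaFun_strictAnti lam).dual_right
      (betaFun_strictAnti mu).dual_right).1 ?_
    exact h
  refine Partition'.ext_parts (funext fun i => ?_)
  have := congrArg OrderDual.ofDual (congrFun h' i)
  simp only [OrderDual.ofDual_toDual] at this
  omega

theorem notMem_betaSet_of_le (lam : Partition') {x : ℤ} (hx : (lam.parts 0 : ℤ) ≤ x) :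
    x ∉ betaSet lam := by
  rintro ⟨i, rfl⟩
  have := lam.antitone 0 i (Nat.zero_le i)
  simp only at hx
  omega

theorem mem_betaSet_of_lt (lam : Partition') {N : ℕ} (hN : ∀ i, N ≤ i → lam.parts i = 0)
    {x : ℤ} (hx : x < -N) : x ∈ betaSet lam := by
  refine ⟨(-x - 1).toNat, ?_⟩
  have := hN (-x - 1).toNat (by omega)
  simp only [this]
  omega

/-- The beta numbers of a partition, as a function on residue classes. -/
noncomputable def betaNum (s : ℕ) (lam : Partition') (i : ZMod s) : ℤ :=
  sInf {x : ℤ | x ∉ betaSet lam ∧ (x : ZMod s) = i}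

theorem isBetaNum_betaNum {s : ℕ} [NeZero s] (lam : Partition') (i : ZMod s) :
    IsBetaNum s lam i (betaNum s lam i) := by
  obtain ⟨N, hN⟩ := lam.finite_support
  have hs : 1 ≤ s := NeZero.one_le
  have hne : {x : ℤ | x ∉ betaSet lam ∧ (x : ZMod s) = i}.Nonempty := by
    refine ⟨(i.val : ℤ) + s * lam.parts 0, notMem_betaSet_of_le lam ?_, by simp⟩
    nlinarith
  have hbdd : BddBelow {x : ℤ | x ∉ betaSet lam ∧ (x : ZMod s) = i} := by
    refine ⟨-N, fun x hx => ?_⟩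
    by_contra h
    exact hx.1 (mem_betaSet_of_lt lam hN (not_le.1 h))
  have hmem := Int.csInf_mem hne hbdd
  refine ⟨hmem.1, hmem.2, fun y hy hyi => ?_⟩
  by_contra h
  exact absurd (csInf_le hbdd ⟨h, hyi⟩) (not_le.2 hy)

theorem isBetaNum_iff {s : ℕ} [NeZero s] {lam : Partition'} {i : ZMod s} {x : ℤ} :
    IsBetaNum s lam i x ↔ x = betaNum s lam i := by
  have h := isBetaNum_betaNum lam i
  refine ⟨fun hx => ?_, fun hx => hx ▸ h⟩
  rcases lt_trichotomy x (betaNum s lam i) with hlt | heq | hgt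
  · exact absurd (h.2.2 x hlt hx.2.1) hx.1
  · exact heq
  · exact absurd (hx.2.2 _ hgt h.2.1) h.1

theorem IsCore.sub_mul_mem {s : ℕ} {lam : Partition'} (h : IsCore lam s) {x : ℤ}
    (hx : x ∈ betaSet lam) (n : ℕ) : x - s * n ∈ betaSet lam := by
  induction n with
  | zero => simpa using hx
  | succ n ih =>
    have := h _ ih
    rwa [show x - (s : ℤ) * n - s = x - s * (n + 1 : ℕ) by push_cast; ring] at this

theorem IsCore.mem_betaSet_iff {s : ℕ} [NeZero s] {lam : Partition'} (h : IsCore lam s) (x : ℤ) :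
    x ∈ betaSet lam ↔ x < betaNum s lam x := by
  have hb := isBetaNum_betaNum lam (x : ZMod s)
  refine ⟨fun hx => ?_, fun hx => hb.2.2 x hx rfl⟩
  by_contra hlt
  rw [not_lt] at hlt
  obtain ⟨k, hk⟩ := (ZMod.intCast_eq_intCast_iff_dvd_sub _ _ s).1 hb.2.1
  have hs : (0 : ℤ) < s := by exact_mod_cast NeZero.pos s
  have hk0 : 0 ≤ k := by
    by_contra hneg
    nlinarith
  lift k to ℕ using hk0
  have := h.sub_mul_mem hx k
  rw [show x - (s : ℤ) * k = betaNum s lam x by omega] at this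
  exact hb.1 this

/-- Counting the beads above a low level on an abacus with `s` runners, where the first
gap on runner `i` is at `M i`. -/
theorem exists_beads_card {s : ℕ} [NeZero s] {M : ZMod s → ℤ} (hM : ∀ i, (M i : ZMod s) = i) :
    ∃ n₀ : ℕ, ∀ n : ℕ, n₀ ≤ n → (∀ i, -((s * n : ℕ) : ℤ) ≤ M i) ∧
      ∃ F : Finset ℤ, (∀ x : ℤ, x ∈ F ↔ -((s * n : ℕ) : ℤ) ≤ x ∧ x < M x) ∧
        (s : ℤ) * F.card = ∑ i, M i - ∑ i : ZMod s, (i.val : ℤ) + s * (s * n) := by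
  have hs : (0 : ℤ) < s := by exact_mod_cast NeZero.pos s
  have hq : ∀ i : ZMod s, ∃ q : ℤ, M i = i.val + s * q := by
    intro i
    obtain ⟨q, hq⟩ := (ZMod.intCast_eq_intCast_iff_dvd_sub (i.val : ℤ) (M i) s).1 (by simp [hM])
    exact ⟨q, by omega⟩
  choose q hq using hq
  refine ⟨∑ i, (q i).natAbs, fun n hn => ?_⟩
  have hqn : ∀ i, 0 ≤ q i + n := by
    intro i
    have : (q i).natAbs ≤ ∑ i, (q i).natAbs :=
      Finset.single_le_sum (f := fun i => (q i).natAbs) (fun _ _ => Nat.zero_le _)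
        (Finset.mem_univ i)
    omega
  refine ⟨fun i => ?_, ?_⟩
  · have := mul_nonneg hs.le (hqn i)
    have h2 := hq i
    push_cast
    nlinarith
  let g : (Σ _ : ZMod s, ℕ) → ℤ := fun p => p.1.val + s * ((p.2 : ℤ) - n)
  have hgcast : ∀ p, (g p : ZMod s) = p.1 := by
    intro p
    simp [g]
  have hg : Function.Injective g := by
    rintro ⟨i, k⟩ ⟨j, l⟩ h
    have hij : i = j := (hgcast ⟨i, k⟩).symm.trans (h ▸ hgcast ⟨j, l⟩)
    subst hij
    have : (s : ℤ) * ((k : ℤ) - n) = s * ((l : ℤ) - n) := by simpa [g] using h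
    have := mul_left_cancel₀ hs.ne' this
    have : k = l := by omega
    rw [this]
  refine ⟨(Finset.univ.sigma fun i => Finset.range (q i + n).toNat).image g, fun x => ?_, ?_⟩
  · simp only [Finset.mem_image, Finset.mem_sigma, Finset.mem_univ, true_and, Finset.mem_range]
    constructor
    · rintro ⟨p, hp, rfl⟩
      rw [hgcast, hq]
      have h1 : (p.2 : ℤ) + 1 ≤ q p.1 + n := by omega
      have h2 := mul_le_mul_of_nonneg_left h1 hs.le
      have h3 : 0 ≤ (s : ℤ) * p.2 := by positivity
      have h4 : (0 : ℤ) ≤ p.1.val := by positivity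
      simp only [g]
      push_cast
      constructor <;> nlinarith
    · rintro ⟨h1, h2⟩
      rw [hq, ZMod.val_intCast] at h2
      have h3 := Int.emod_add_mul_ediv x s
      have h4 := Int.emod_lt_of_pos x hs
      push_cast at h1
      have h5 : 0 ≤ x / s + n := by
        by_contra hneg
        have : x / s + n ≤ -1 := by omega
        nlinarith
      have h6 : x / s < q x := by
        by_contra hneg
        rw [not_lt] at hneg
        nlinarith
      refine ⟨⟨(x : ZMod s), (x / s + n).toNat⟩, ?_, ?_⟩
      · simp only
        omega
      · simp only [g, ZMod.val_intCast]
        rw [Int.toNat_of_nonneg h5]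
        linarith [h3, show (s : ℤ) * (x / s + n - n) = s * (x / s) by ring]
  · rw [Finset.card_image_of_injective _ hg, Finset.card_sigma]
    simp only [Finset.card_range]
    push_cast
    rw [Finset.sum_congr rfl fun i _ => Int.toNat_of_nonneg (hqn i), Finset.mul_sum,
      ← Finset.sum_sub_distrib, Finset.sum_congr rfl fun i _ =>
        show (s : ℤ) * (q i + n) = (M i - i.val) + s * n by rw [hq]; ring,
      Finset.sum_add_distrib]
    simp

/-- Positions of the first gaps on the runners of an `s`-runner abacus of charge zero. -/
def IsBalancedAbacus {s : ℕ} [NeZero s] (M : ZMod s → ℤ) : Prop :=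
  (∀ i, (M i : ZMod s) = i) ∧ ∑ i, M i = ∑ i : ZMod s, (i.val : ℤ)

theorem IsCore.isBalancedAbacus {s : ℕ} [NeZero s] {lam : Partition'} (h : IsCore lam s) :
    IsBalancedAbacus (betaNum s lam) := by
  have hM : ∀ i, (betaNum s lam i : ZMod s) = i := fun i => (isBetaNum_betaNum lam i).2.1
  refine ⟨hM, ?_⟩
  obtain ⟨n₀, hn₀⟩ := exists_beads_card hM
  obtain ⟨N, hN⟩ := lam.finite_support
  obtain ⟨-, F, hF, hcard⟩ := hn₀ (max n₀ N) (le_max_left _ _)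
  have hs : 1 ≤ s := NeZero.one_le
  have hNle : N ≤ s * max n₀ N := by nlinarith [le_max_right n₀ N]
  generalize max n₀ N = n at *
  have hFi : F = (Finset.range (s * n)).image fun i : ℕ => (lam.parts i : ℤ) - (i + 1) := by
    ext x
    rw [hF, ← h.mem_betaSet_iff]
    simp only [Finset.mem_image, Finset.mem_range, betaSet, Set.mem_range]
    constructor
    · rintro ⟨h1, i, rfl⟩
      refine ⟨i, ?_, rfl⟩
      by_contra hi
      have := hN i (by omega)
      omega
    · rintro ⟨i, hi, rfl⟩
      exact ⟨by omega, i, rfl⟩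
  rw [hFi, Finset.card_image_of_injective _ (betaFun_strictAnti lam).injective,
    Finset.card_range] at hcard
  push_cast at hcard
  linarith

theorem exists_partition_of_strictAnti {f : ℕ → ℤ} (hf : StrictAnti f) {N : ℕ}
    (hN : ∀ i, N ≤ i → f i = -(i + 1)) : ∃ lam : Partition', betaSet lam = Set.range f := by
  have hanti : Antitone fun i : ℕ => f i + (i + 1) := by
    refine antitone_nat_of_succ_le fun n => ?_
    have := hf (Nat.lt_succ_self n)
    push_cast
    simp only [Nat.succ_eq_add_one] at this
    omega
  have hnonneg : ∀ i : ℕ, 0 ≤ f i + (i + 1) := by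
    intro i
    have h1 := hanti (le_max_left i N)
    have h2 := hN (max i N) (le_max_right i N)
    simp only [h2] at h1
    omega
  refine ⟨⟨fun i => (f i + (i + 1)).toNat, fun i j hij => Int.toNat_le_toNat (hanti hij),
    N, fun i hi => ?_⟩, ?_⟩
  · simp [hN i hi]
  · refine congrArg Set.range (funext fun i => ?_)
    rw [Int.toNat_of_nonneg (hnonneg i)]
    ring

theorem IsBalancedAbacus.exists_core {s : ℕ} [NeZero s] {M : ZMod s → ℤ}
    (h : IsBalancedAbacus M) : ∃ lam : Partition', IsCore lam s ∧ betaNum s lam = M := by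
  obtain ⟨n, hn⟩ := exists_beads_card h.1
  obtain ⟨hle, F, hF, hcard⟩ := hn n le_rfl
  have hs : (0 : ℤ) < s := by exact_mod_cast NeZero.pos s
  have hFc : F.card = s * n := by
    rw [h.2, sub_self, zero_add] at hcard
    exact_mod_cast mul_left_cancel₀ hs.ne' hcard
  let e := F.orderEmbOfFin hFc
  have heF : ∀ j, -((s * n : ℕ) : ℤ) ≤ e j := fun j => ((hF _).1 (F.orderEmbOfFin_mem hFc j)).1
  let f : ℕ → ℤ := fun i => if hi : i < s * n then e (Fin.rev ⟨i, hi⟩) else -(i + 1)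
  have hfanti : StrictAnti f := by
    intro i j hij
    simp only [f]
    split_ifs with h1 h2 h2
    · refine e.strictMono (Fin.rev_lt_rev.2 hij)
    · omega
    · have := heF (Fin.rev ⟨i, h2⟩)
      omega
    · omega
  obtain ⟨lam, hlam⟩ := exists_partition_of_strictAnti hfanti (N := s * n)
    (fun i hi => by simp [f, not_lt.2 hi])
  have hmem : ∀ x : ℤ, x ∈ betaSet lam ↔ x < M x := by
    intro x
    rw [hlam]
    constructor
    · rintro ⟨i, rfl⟩
      by_cases hi : i < s * n
      · simp only [f, hi, dif_pos]
        exact ((hF _).1 (F.orderEmbOfFin_mem hFc _)).2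
      · have := hle ((f i : ℤ) : ZMod s)
        refine lt_of_lt_of_le ?_ this
        simp only [f, hi, dif_neg, not_false_eq_true]
        omega
    · intro hx
      by_cases hxl : -((s * n : ℕ) : ℤ) ≤ x
      · have hxF : x ∈ Set.range e := by
          rw [Finset.range_orderEmbOfFin]
          exact (hF x).2 ⟨hxl, hx⟩
        obtain ⟨j, rfl⟩ := hxF
        refine ⟨(Fin.rev j : Fin (s * n)), ?_⟩
        simp only [f]
        rw [dif_pos (Fin.rev j).isLt, Fin.eta, Fin.rev_rev]
      · refine ⟨(-x - 1).toNat, ?_⟩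
        simp only [f]
        rw [dif_neg (by omega)]
        omega
  refine ⟨lam, fun x hx => ?_, funext fun i => ?_⟩
  · rw [hmem] at hx ⊢
    simp only [Int.cast_sub, Int.cast_natCast, CharP.cast_eq_zero, sub_zero]
    omega
  · refine (isBetaNum_iff.1 ⟨?_, h.1 i, fun y hy hyi => ?_⟩).symm
    · rw [hmem, h.1]
      exact lt_irrefl _
    · rw [hmem, hyi]
      exact hy

theorem IsCore.ext_betaNum {s : ℕ} [NeZero s] {lam mu : Partition'} (hl : IsCore lam s)
    (hm : IsCore mu s) (h : betaNum s lam = betaNum s mu) : lam = mu := by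
  refine betaSet_injective (Set.ext fun x => ?_)
  rw [hl.mem_betaSet_iff, hm.mem_betaSet_iff, h]

theorem ZMod.apply_eq_apply_zero_of_add_isUnit {s : ℕ} [NeZero s] {d : ZMod s} (hd : IsUnit d)
    {α : Type*} {f : ZMod s → α} (hf : ∀ i, f (i + d) = f i) (i : ZMod s) : f i = f 0 := by
  obtain ⟨u, rfl⟩ := hd
  have h : ∀ n : ℕ, f (n * u) = f 0 := by
    intro n
    induction n with
    | zero => simp
    | succ n ih => rw [← ih, ← hf (n * u)]; push_cast; ring_nf
  have := h (i * ↑u⁻¹ : ZMod s).val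
  rwa [ZMod.natCast_zmod_val, mul_assoc, Units.inv_mul, mul_one] at this

theorem ZMod.sum_range_natCast {s : ℕ} [NeZero s] (g : ZMod s → ℤ) :
    ∑ k ∈ Finset.range s, g k = ∑ i, g i := by
  refine Finset.sum_bij (fun k _ => (k : ZMod s)) (fun _ _ => Finset.mem_univ _) ?_ ?_
    (fun _ _ => rfl)
  · intro k hk l hl h
    have := congrArg ZMod.val h
    rwa [ZMod.val_natCast_of_lt (Finset.mem_range.1 hk),
      ZMod.val_natCast_of_lt (Finset.mem_range.1 hl)] at this
  · exact fun i _ => ⟨i.val, Finset.mem_range.2 (ZMod.val_lt i), ZMod.natCast_zmod_val i⟩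

theorem ZMod.exists_primitive {s : ℕ} [NeZero s] {g : ZMod s → ℤ} (hg : ∑ i, g i = 0) :
    ∃ h : ZMod s → ℤ, ∀ i, h (i + 1) = h i + g i := by
  refine ⟨fun i => ∑ k ∈ Finset.range i.val, g k, fun i => ?_⟩
  have key : ∑ k ∈ Finset.range i.val, g k + g i = ∑ k ∈ Finset.range (i.val + 1), g k := by
    rw [Finset.sum_range_succ, ZMod.natCast_zmod_val]
  simp only [key]
  have hcast : ((i.val + 1 : ℕ) : ZMod s) = i + 1 := by simp
  rcases (Nat.succ_le_of_lt (ZMod.val_lt i)).lt_or_eq with hlt | heq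
  · rw [← hcast, ZMod.val_natCast_of_lt hlt]
  · have h0 : i + 1 = 0 := by
      rw [← hcast, ← Nat.succ_eq_add_one, heq, ZMod.natCast_self]
    rw [h0, ← Nat.succ_eq_add_one, heq, ZMod.sum_range_natCast, hg]
    simp

theorem ZMod.exists_primitive_of_isUnit {s : ℕ} [NeZero s] {d : ZMod s} (hd : IsUnit d)
    {g : ZMod s → ℤ} (hg : ∑ i, g i = 0) :
    ∃ h : ZMod s → ℤ, h 0 = 0 ∧ ∀ i, h (i + d) = h i + g i := by
  obtain ⟨u, rfl⟩ := hd
  have hg' : ∑ j : ZMod s, g (j * u) = 0 := by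
    rw [← hg]
    exact Equiv.sum_comp (Units.mulRight u) g
  obtain ⟨h, hh⟩ := ZMod.exists_primitive hg'
  refine ⟨fun i => h (i * ↑u⁻¹) - h 0, by simp, fun i => ?_⟩
  have := hh (i * ↑u⁻¹)
  rw [mul_assoc, Units.inv_mul, mul_one] at this
  simp only [add_mul, Units.mul_inv, this]
  ring

/-- `L` is obtained from `M` by translating by `c` and lowering by `s` the runners in some set. -/
def IsLowering {s : ℕ} (c : ℤ) (L M : ZMod s → ℤ) : Prop :=
  ∀ i, M i + c = L (i + c) ∨ M i + c = L (i + c) + s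

open Classical in
/-- The runners that are lowered in passing from `M` to `L`, translated by `k`. -/
noncomputable def loweredSet {s : ℕ} [NeZero s] (c : ℤ) (L M : ZMod s → ℤ) (k : ZMod s) :
    Finset (ZMod s) :=
  Finset.univ.filter fun i => M (i - k) + c = L (i - k + c) + s

theorem mem_loweredSet {s : ℕ} [NeZero s] {c : ℤ} {L M : ZMod s → ℤ} {k i : ZMod s} :
    i ∈ loweredSet c L M k ↔ M (i - k) + c = L (i - k + c) + s := by
  simp [loweredSet]

theorem IsLowering.eq {s : ℕ} [NeZero s] {c : ℤ} {L M : ZMod s → ℤ} (h : IsLowering c L M)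
    (k i : ZMod s) :
    L (i - k + c) = M (i - k) + c - if i ∈ loweredSet c L M k then (s : ℤ) else 0 := by
  have := h (i - k)
  have hs : (s : ℤ) ≠ 0 := by exact_mod_cast NeZero.ne s
  split_ifs with hi <;> rw [mem_loweredSet] at hi
  · omega
  · rcases this with h | h
    · omega
    · exact absurd h hi

theorem IsLowering.card_loweredSet {s : ℕ} [NeZero s] {c : ℕ} {L M : ZMod s → ℤ}
    (h : IsLowering c L M) (hLM : ∑ i, L i = ∑ i, M i) (k : ZMod s) :
    (loweredSet c L M k).card = c := by
  have hs : (s : ℤ) ≠ 0 := by exact_mod_cast NeZero.ne s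
  have h1 := Finset.sum_congr rfl fun (i : ZMod s) (_ : i ∈ Finset.univ) => h.eq k i
  have h2 : ∑ i, L (i - k + ((c : ℤ) : ZMod s)) = ∑ i, L i :=
    Equiv.sum_comp ((Equiv.subRight k).trans (Equiv.addRight _)) L
  have h3 : ∑ i, M (i - k) = ∑ i, M i := Equiv.sum_comp (Equiv.subRight k) M
  rw [h2, Finset.sum_sub_distrib, Finset.sum_add_distrib, h3, Finset.sum_ite_mem,
    Finset.univ_inter] at h1
  simp only [Finset.sum_const, Finset.card_univ, ZMod.card, nsmul_eq_mul] at h1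
  have h4 : ((loweredSet c L M k).card : ℤ) * s = c * s := by linarith
  exact_mod_cast mul_right_cancel₀ hs h4

theorem IsLowering.step {s : ℕ} [NeZero s] {a b : ℤ} {L M : ZMod s → ℤ}
    (ha : IsLowering a L M) (hb : IsLowering b L M) (k i : ZMod s) :
    M (i + (a - b : ℤ) - k) = M (i - k) + (a - b)
      - (if i ∈ loweredSet a L M k then (s : ℤ) else 0)
      + if i + (a - b : ℤ) ∈ loweredSet b L M k then (s : ℤ) else 0 := by
  have h1 := ha.eq k i
  have h2 := hb.eq k (i + (a - b : ℤ))
  rw [show i + ((a - b : ℤ) : ZMod s) - k + (b : ZMod s) = i - k + a by push_cast; ring] at h2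
  linarith

/-- Pairs of balanced abaci, the first being a lowering of the second by both `a` and `b`. -/
def abacusPairs (s : ℕ) [NeZero s] (a b : ℤ) : Set ((ZMod s → ℤ) × (ZMod s → ℤ)) :=
  {p | IsBalancedAbacus p.1 ∧ IsBalancedAbacus p.2 ∧ IsLowering a p.1 p.2 ∧ IsLowering b p.1 p.2}

/-- The lowered sets of a pair of abaci, both translated by a common amount. -/
noncomputable def loweredPair {s : ℕ} [NeZero s] (a b : ℤ)
    (q : ((ZMod s → ℤ) × (ZMod s → ℤ)) × ZMod s) : Finset (ZMod s) × Finset (ZMod s) :=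
  (loweredSet a q.1.1 q.1.2 q.2, loweredSet b q.1.1 q.1.2 q.2)

theorem loweredPair_injOn {s : ℕ} [NeZero s] {a b : ℤ} (hd : IsUnit ((a - b : ℤ) : ZMod s)) :
    Set.InjOn (loweredPair a b) (abacusPairs s a b ×ˢ Set.univ) := by
  rintro ⟨⟨L, M⟩, k⟩ ⟨⟨hL, hM, ha, hb⟩, -⟩ ⟨⟨L', M'⟩, k'⟩ ⟨⟨hL', hM', ha', hb'⟩, -⟩ h
  simp only [loweredPair, Prod.mk.injEq] at hL hM ha hb hL' hM' ha' hb' h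
  obtain ⟨hA, hB⟩ := h
  have hconst := ZMod.apply_eq_apply_zero_of_add_isUnit hd
    (f := fun i => M (i - k) - M' (i - k')) fun i => by
      have h1 := ha.step hb k i
      have h2 := ha'.step hb' k' i
      rw [← hA, ← hB] at h2
      linarith
  have hs : (s : ℤ) ≠ 0 := by exact_mod_cast NeZero.ne s
  have hzero : M (0 - k) - M' (0 - k') = 0 := by
    have h1 : ∑ i, M (i - k) = ∑ i, M i := Equiv.sum_comp (Equiv.subRight k) M
    have h2 : ∑ i, M' (i - k') = ∑ i, M' i := Equiv.sum_comp (Equiv.subRight k') M'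
    have h3 := Finset.sum_congr rfl fun (i : ZMod s) (_ : i ∈ Finset.univ) => hconst i
    rw [Finset.sum_sub_distrib, h1, h2, hM.2, hM'.2, sub_self] at h3
    simp only [Finset.sum_const, Finset.card_univ, ZMod.card, nsmul_eq_mul] at h3
    exact (mul_eq_zero.1 h3.symm).resolve_left hs
  have hkk : k = k' := by
    have := congrArg (Int.cast : ℤ → ZMod s) hzero
    push_cast at this
    rw [hM.1, hM'.1] at this
    linear_combination -this
  subst hkk
  have hMM : M = M' := funext fun i => by
    have := hconst (i + k)
    simp only [hzero, add_sub_cancel_right] at this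
    omega
  subst hMM
  have hLL : L = L' := funext fun i => by
    have h1 := ha.eq k (i + k - a)
    have h2 := ha'.eq k (i + k - a)
    rw [← hA, ← h1] at h2
    simpa [show i + k - (a : ZMod s) - k + a = i by ring] using h2.symm
  rw [hLL]

theorem exists_loweredPair_eq {s : ℕ} [NeZero s] {a b : ℕ}
    (hd : IsUnit ((a - b : ℤ) : ZMod s)) {A B : Finset (ZMod s)} (hA : A.card = a)
    (hB : B.card = b) :
    ∃ q ∈ abacusPairs s a b ×ˢ (Set.univ : Set (ZMod s)), loweredPair a b q = (A, B) := by
  have hs : (s : ℤ) ≠ 0 := by exact_mod_cast NeZero.ne s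
  have hsum : ∀ (C : Finset (ZMod s)) (c : ZMod s),
      ∑ i, (if i + c ∈ C then (s : ℤ) else 0) = C.card * s := by
    intro C c
    rw [← Equiv.sum_comp (Equiv.subRight c)]
    simp only [Equiv.subRight_apply, sub_add_cancel]
    rw [Finset.sum_ite_mem, Finset.univ_inter]
    simp
  obtain ⟨h, h0, hstep⟩ := ZMod.exists_primitive_of_isUnit hd
    (g := fun i => (a - b : ℤ) - (if i ∈ A then (s : ℤ) else 0)
      + if i + (a - b : ℤ) ∈ B then (s : ℤ) else 0) (by
        have := hsum A 0
        simp only [add_zero] at this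
        rw [Finset.sum_add_distrib, Finset.sum_sub_distrib, hsum, this, hA, hB]
        simp
        ring)
  have hcast : ∀ i, (h i : ZMod s) = i := by
    intro i
    have := ZMod.apply_eq_apply_zero_of_add_isUnit hd
      (f := fun i => (h i : ZMod s) - i) (fun i => by
        simp only [hstep]
        split_ifs <;> push_cast <;> simp) i
    simpa [h0, sub_eq_zero] using this
  obtain ⟨m, hm⟩ : (s : ℤ) ∣ ∑ i, h i - ∑ i : ZMod s, (i.val : ℤ) := by
    rw [← ZMod.intCast_zmod_eq_zero_iff_dvd]
    simp [hcast]
  let M : ZMod s → ℤ := fun i => h (i + m) - m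
  let L : ZMod s → ℤ := fun i => M (i - a) + a - if i - a + m ∈ A then (s : ℤ) else 0
  have hMsum : ∑ i, M i = ∑ i : ZMod s, (i.val : ℤ) := by
    simp only [M]
    rw [Finset.sum_sub_distrib, show ∑ i, h (i + m) = ∑ i, h i from
      Equiv.sum_comp (Equiv.addRight (m : ZMod s)) h]
    simp only [Finset.sum_const, Finset.card_univ, ZMod.card, nsmul_eq_mul]
    linarith
  have hMcast : ∀ i, (M i : ZMod s) = i := by simp [M, hcast]
  have hLa : ∀ i, L (i + (a : ℤ)) = M i + a - if i + m ∈ A then (s : ℤ) else 0 := by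
    simp [L]
  have hLb : ∀ i, L (i + (b : ℤ)) = M i + b - if i + m ∈ B then (s : ℤ) else 0 := by
    intro i
    have h1 := hstep (i - (a - b : ℤ) + m)
    have h2 := hLa (i - (a - b : ℤ))
    rw [show i - ((a - b : ℤ) : ZMod s) + m + ((a - b : ℤ) : ZMod s) = i + m by ring] at h1
    rw [show i - ((a - b : ℤ) : ZMod s) + ((a : ℤ) : ZMod s) = i + (b : ℤ) by
      push_cast; ring] at h2
    simp only [M] at h2 ⊢
    linarith
  have hLsum : ∑ i, L i = ∑ i : ZMod s, (i.val : ℤ) := by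
    rw [← Equiv.sum_comp (Equiv.addRight ((a : ℤ) : ZMod s)) L]
    simp only [Equiv.coe_addRight, hLa]
    rw [Finset.sum_sub_distrib, Finset.sum_add_distrib, hsum, hMsum, hA]
    simp
    ring
  have hLcast : ∀ i, (L i : ZMod s) = i := by
    intro i
    simp only [L]
    split_ifs <;> simp [hMcast]
  have hlow : ∀ (c : ℤ) (C : Finset (ZMod s)),
      (∀ i, L (i + c) = M i + c - if i + m ∈ C then (s : ℤ) else 0) →
        IsLowering c L M ∧ loweredSet c L M m = C := by
    intro c C hC
    refine ⟨fun i => ?_, Finset.ext fun i => ?_⟩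
    · rw [hC]
      split_ifs
      · right; ring
      · left; ring
    · rw [mem_loweredSet, hC, sub_add_cancel]
      split_ifs with hi
      · simp [hi]
      · simp only [hi, iff_false]
        omega
  obtain ⟨ha1, ha2⟩ := hlow a A hLa
  obtain ⟨hb1, hb2⟩ := hlow b B hLb
  exact ⟨((L, M), m), ⟨⟨⟨hLcast, hLsum⟩, ⟨hMcast, hMsum⟩, ha1, hb1⟩, Set.mem_univ _⟩,
    Prod.ext ha2 hb2⟩

theorem ncard_abacusPairs {s : ℕ} [NeZero s] {a b : ℕ} (hd : IsUnit ((a - b : ℤ) : ZMod s)) :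
    s * (abacusPairs s a b).ncard = s.choose a * s.choose b := by
  have himage : loweredPair (a : ℤ) (b : ℤ) '' (abacusPairs s a b ×ˢ Set.univ) =
      ((Finset.univ.powersetCard a ×ˢ Finset.univ.powersetCard b :
        Finset (Finset (ZMod s) × Finset (ZMod s))) : Set _) := by
    ext ⟨A, B⟩
    simp only [Finset.coe_product, Set.mem_prod, Finset.mem_coe, Finset.mem_powersetCard,
      Finset.subset_univ, true_and]
    constructor
    · rintro ⟨⟨⟨L, M⟩, k⟩, ⟨⟨hL, hM, ha, hb⟩, -⟩, h⟩
      obtain ⟨rfl, rfl⟩ := Prod.mk.inj h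
      have hLM := hL.2.trans hM.2.symm
      exact ⟨ha.card_loweredSet hLM k, hb.card_loweredSet hLM k⟩
    · rintro ⟨hA, hB⟩
      exact exists_loweredPair_eq hd hA hB
  have h := (loweredPair_injOn hd).ncard_image
  rw [himage, Set.ncard_coe_finset, Set.ncard_prod] at h
  simp only [Finset.card_product, Finset.card_powersetCard, Finset.card_univ, ZMod.card,
    Set.ncard_univ, Nat.card_eq_fintype_card] at h
  rw [h, mul_comm]

/-- for `s ≥ 1` and `0 ≤ a, b < s` with `gcd(s, a - b) = 1`, the
number of pairs `(λ, μ)` of `s`-cores with `β_i(μ) + a ∈ {β_{i+a}(λ), β_{i+a}(λ)+s}`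
for all `i`, and likewise with `b` in place of `a`, is `(1/s)·C(s,a)·C(s,b)`. -/
theorem stmt_15 (s a b : ℕ) (hs : 0 < s) (ha : a < s) (hb : b < s)
    (hgcd : Int.gcd (s : ℤ) ((a : ℤ) - b) = 1) :
    s * {p : Partition' × Partition' |
        IsCore p.1 s ∧ IsCore p.2 s ∧
        (∀ (i : ZMod s) (x y : ℤ), IsBetaNum s p.2 i x →
          IsBetaNum s p.1 (i + (a : ZMod s)) y → x + a = y ∨ x + a = y + s) ∧
        (∀ (i : ZMod s) (x y : ℤ), IsBetaNum s p.2 i x →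
          IsBetaNum s p.1 (i + (b : ZMod s)) y → x + b = y ∨ x + b = y + s)}.ncard =
      s.choose a * s.choose b := by
  have : NeZero s := ⟨hs.ne'⟩
  have hd : IsUnit ((a - b : ℤ) : ZMod s) := by
    rw [ZMod.coe_int_isUnit_iff_isCoprime]
    exact Int.isCoprime_iff_gcd_eq_one.2 hgcd
  rw [← ncard_abacusPairs hd]
  congr 1
  have hlow : ∀ (p : Partition' × Partition') (c : ℕ),
      (∀ (i : ZMod s) (x y : ℤ), IsBetaNum s p.2 i x →
        IsBetaNum s p.1 (i + (c : ZMod s)) y → x + c = y ∨ x + c = y + s) ↔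
      IsLowering c (betaNum s p.1) (betaNum s p.2) := by
    intro p c
    simp [isBetaNum_iff, IsLowering]
  simp only [hlow]
  refine Set.ncard_congr (fun p _ => (betaNum s p.1, betaNum s p.2)) ?_ ?_ ?_
  · rintro p ⟨h1, h2, h3, h4⟩
    exact ⟨h1.isBalancedAbacus, h2.isBalancedAbacus, h3, h4⟩
  · rintro p q ⟨h1, h2, -⟩ ⟨h3, h4, -⟩ h
    obtain ⟨h5, h6⟩ := Prod.mk.inj h
    exact Prod.ext (h1.ext_betaNum h3 h5) (h2.ext_betaNum h4 h6)
  · rintro ⟨L, M⟩ ⟨hL, hM, h1, h2⟩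
    obtain ⟨lam, hlam, rfl⟩ := hL.exists_core
    obtain ⟨mu, hmu, rfl⟩ := hM.exists_core
    exact ⟨(lam, mu), ⟨hlam, hmu, h1, h2⟩, rfl⟩
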